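/- Let k ≥ 1, let γ : Fin k → I and β ∈ I, and let m be an integer with m ≥ n. For each (r,s) ∈ ℤ^k × ℤ with r(0)+⋯+r(k−1)+s = m, define the normally ordered monomial applied to the vacuum: P(r,s) := a*(γ(0),r(0))⋯a*(γ(k−1),r(k−1))·a(β,s)·u_n if s ≥ 0, and P(r,s) := a(β,s)·a*(γ(0),r(0))⋯a*(γ(k−1),r(k−1))·u_n if s < 0. Then the family P(r,s) has finite support and ∑ P(r,s) = 0 in M_n. (By linearity this is Lemma: for any polynomial T in the generating fields a*_γ(z) with no constant term, [:T(a*(z)) a_β(z):]_m · u_n = 0 for all m ≥ n.) -/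

import Mathlib

noncomputable section

/-- Generators of the infinite-dimensional Weyl algebra: `a γ r` and `as γ r`
(the latter playing the role of `a*(γ,r)`), for `γ ∈ I`, `r ∈ ℤ`. -/
inductive WGen (I : Type) : Type
  | a : I → ℤ → WGen I
  | as : I → ℤ → WGen I

open FreeAlgebra in
/-- The defining relations of the infinite-dimensional Weyl algebra `𝒜`:
`a(γ,r)·a*(δ,s) − a*(δ,s)·a(γ,r) = (1 if γ = δ and r = −s, else 0)`, while the `a`'s
commute among themselves and the `a*`'s commute among themselves. -/
inductive WeylRel (I : Type) : FreeAlgebra ℂ (WGen I) → FreeAlgebra ℂ (WGen I) → Prop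
  | a_as_eq (γ : I) (r : ℤ) :
      WeylRel I (ι ℂ (WGen.a γ r) * ι ℂ (WGen.as γ (-r)))
        (ι ℂ (WGen.as γ (-r)) * ι ℂ (WGen.a γ r) + 1)
  | a_as_ne (γ δ : I) (r s : ℤ) (h : γ ≠ δ ∨ r ≠ -s) :
      WeylRel I (ι ℂ (WGen.a γ r) * ι ℂ (WGen.as δ s))
        (ι ℂ (WGen.as δ s) * ι ℂ (WGen.a γ r))
  | a_a (γ δ : I) (r s : ℤ) :
      WeylRel I (ι ℂ (WGen.a γ r) * ι ℂ (WGen.a δ s))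
        (ι ℂ (WGen.a δ s) * ι ℂ (WGen.a γ r))
  | as_as (γ δ : I) (r s : ℤ) :
      WeylRel I (ι ℂ (WGen.as γ r) * ι ℂ (WGen.as δ s))
        (ι ℂ (WGen.as δ s) * ι ℂ (WGen.as γ r))

/-- The infinite-dimensional Weyl algebra `𝒜`: the quotient of the free ℂ-algebra on
the generators `a(γ,r)`, `a*(γ,r)` by the two-sided ideal generated by the relations. -/
abbrev WeylAlg (I : Type) : Type := RingQuot (WeylRel I)

/-- The generator `a(γ,r)` of `𝒜`. -/
def wa {I : Type} (γ : I) (r : ℤ) : WeylAlg I :=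
  RingQuot.mkAlgHom ℂ (WeylRel I) (FreeAlgebra.ι ℂ (WGen.a γ r))

/-- The generator `a*(γ,r)` of `𝒜`. -/
def was {I : Type} (γ : I) (r : ℤ) : WeylAlg I :=
  RingQuot.mkAlgHom ℂ (WeylRel I) (FreeAlgebra.ι ℂ (WGen.as γ r))

/-- The left ideal of `𝒜` generated by the `a(γ,r)` with `r ≥ n` and the
`a*(γ,r)` with `r ≥ 1 − n`. -/
def fockIdeal (I : Type) (n : ℕ) : Submodule (WeylAlg I) (WeylAlg I) :=
  Submodule.span (WeylAlg I)
    ({x | ∃ γ : I, ∃ r : ℤ, (n : ℤ) ≤ r ∧ x = wa γ r} ∪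
     {x | ∃ γ : I, ∃ r : ℤ, 1 - (n : ℤ) ≤ r ∧ x = was γ r})

/-- The Fock module `M_n = 𝒜 / 𝒜·(a(γ,r) : r ≥ n, a*(γ,r) : r ≥ 1−n)`,
a left `𝒜`-module. -/
abbrev Fock (I : Type) (n : ℕ) : Type := WeylAlg I ⧸ fockIdeal I n

/-- The vacuum vector `u_n ∈ M_n`, the image of `1 ∈ 𝒜`. -/
def fockVac (I : Type) (n : ℕ) : Fock I n := Submodule.Quotient.mk 1


/-- The normally ordered monomial `:a*(γ 0, r 0)⋯a*(γ (k−1), r (k−1)) a(β,s):` applied to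
the vacuum `u_n`: the annihilation operator `a(β,s)` is placed to the right when `s ≥ 0`
and to the left when `s < 0`. -/
def nordTerm {I : Type} (n : ℕ) {k : ℕ} (γ : Fin k → I) (β : I)
    (rs : (Fin k → ℤ) × ℤ) : Fock I n :=
  if 0 ≤ rs.2 then
    ((List.ofFn fun i => was (γ i) (rs.1 i)).prod * wa β rs.2) • fockVac I n
  else
    (wa β rs.2 * (List.ofFn fun i => was (γ i) (rs.1 i)).prod) • fockVac I n

theorem List.prod_smul_eq_zero_of_mem {A M : Type*} [Ring A] [AddCommGroup M] [Module A M]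
    {l : List A} (hl : ∀ x ∈ l, ∀ y ∈ l, Commute x y) {x : A} (hx : x ∈ l) {v : M}
    (hv : x • v = 0) : l.prod • v = 0 := by
  induction l with
  | nil => simp at hx
  | cons b l ih =>
    rw [List.prod_cons]
    rcases List.mem_cons.1 hx with rfl | hx
    · have hc : Commute x l.prod := Commute.list_prod_right _ _ fun y hy =>
        hl x List.mem_cons_self y (List.mem_cons_of_mem _ hy)
      rw [hc.eq, mul_smul, hv, smul_zero]
    · rw [mul_smul, ih (fun y hy z hz => hl y (List.mem_cons_of_mem _ hy) z
        (List.mem_cons_of_mem _ hz)) hx, smul_zero]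

theorem was_commute {I : Type} (γ δ : I) (r s : ℤ) : Commute (was γ r) (was δ s) := by
  simpa only [was, map_mul, commute_iff_eq] using RingQuot.mkAlgHom_rel ℂ (WeylRel.as_as γ δ r s)

theorem wa_commute_was {I : Type} {γ δ : I} {r s : ℤ} (h : γ ≠ δ ∨ r ≠ -s) :
    Commute (wa γ r) (was δ s) := by
  simpa only [wa, was, map_mul, commute_iff_eq] using RingQuot.mkAlgHom_rel ℂ (WeylRel.a_as_ne γ δ r s h)

theorem smul_fockVac_eq_zero {I : Type} {n : ℕ} {x : WeylAlg I} (hx : x ∈ fockIdeal I n) :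
    x • fockVac I n = 0 := by
  rw [fockVac, ← Submodule.Quotient.mk_smul, smul_eq_mul, mul_one]
  exact (Submodule.Quotient.mk_eq_zero _).2 hx

theorem wa_smul_fockVac {I : Type} {n : ℕ} (γ : I) {r : ℤ} (hr : (n : ℤ) ≤ r) :
    wa γ r • fockVac I n = 0 :=
  smul_fockVac_eq_zero (Submodule.subset_span (Or.inl ⟨γ, r, hr, rfl⟩))

theorem was_smul_fockVac {I : Type} {n : ℕ} (γ : I) {r : ℤ} (hr : 1 - (n : ℤ) ≤ r) :
    was γ r • fockVac I n = 0 :=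
  smul_fockVac_eq_zero (Submodule.subset_span (Or.inr ⟨γ, r, hr, rfl⟩))

theorem prod_was_smul_eq_zero {I : Type} {n k : ℕ} (γ : Fin k → I) (r : Fin k → ℤ)
    (i : Fin k) {v : Fock I n} (hv : was (γ i) (r i) • v = 0) :
    (List.ofFn fun i => was (γ i) (r i)).prod • v = 0 := by
  refine List.prod_smul_eq_zero_of_mem ?_ (List.mem_ofFn.2 ⟨i, rfl⟩) hv
  intro x hx y hy
  obtain ⟨i, rfl⟩ := List.mem_ofFn.1 hx
  obtain ⟨j, rfl⟩ := List.mem_ofFn.1 hy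
  exact was_commute _ _ _ _

/-- Every normally ordered monomial of total degree at least `n` kills the vacuum: if `a(β,s)`
does not, then some `a*` factor has positive degree, hence commutes with `a(β,s)` when `0 ≤ s`
and annihilates the vacuum. -/
theorem nordTerm_eq_zero {I : Type} {n k : ℕ} (γ : Fin k → I) (β : I)
    (rs : (Fin k → ℤ) × ℤ) (h : (n : ℤ) ≤ (∑ i, rs.1 i) + rs.2) : nordTerm n γ β rs = 0 := by
  obtain ⟨r, s⟩ := rs
  dsimp only at h
  by_cases hsn : (n : ℤ) ≤ s
  · rw [nordTerm, if_pos (by dsimp only; omega), mul_smul, wa_smul_fockVac β hsn, smul_zero]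
  obtain ⟨i, -, hi⟩ : ∃ i ∈ Finset.univ, 0 < r i :=
    Finset.exists_lt_of_sum_lt (by rw [Finset.sum_const_zero]; omega)
  have hvac : was (γ i) (r i) • fockVac I n = 0 := was_smul_fockVac _ (by omega)
  rw [nordTerm]
  split_ifs with hs
  · dsimp only at hs
    rw [mul_smul]
    refine prod_was_smul_eq_zero γ r i ?_
    rw [smul_smul, ← (wa_commute_was (Or.inr (by omega))).eq, mul_smul, hvac, smul_zero]
  · rw [mul_smul, prod_was_smul_eq_zero γ r i hvac, smul_zero]

/-!
STATEMENT 3: for `k ≥ 1`, `γ : Fin k → I`, `β ∈ I` and an integer `m ≥ n`, the family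
of normally ordered monomials `P(r,s)` applied to the vacuum, indexed by those
`(r,s) ∈ ℤ^k × ℤ` with `r 0 + ⋯ + r (k−1) + s = m`, has finite support and sums to `0`
in `M_n`; i.e. `[:T(a*(z)) a_β(z):]_m · u_n = 0` for every polynomial `T` in the fields
`a*_γ(z)` with no constant term, for all `m ≥ n`.
-/
theorem nord_mode_on_vacuum_of_ge
    (n : ℕ) (hn : 1 ≤ n) (I : Type) (k : ℕ) (hk : 1 ≤ k) (γ : Fin k → I) (β : I)
    (m : ℤ) (hm : (n : ℤ) ≤ m) :
    (Function.support (fun rs : (Fin k → ℤ) × ℤ =>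
        if (∑ i, rs.1 i) + rs.2 = m then nordTerm n γ β rs else 0)).Finite ∧
    (∑ᶠ rs : (Fin k → ℤ) × ℤ,
        (if (∑ i, rs.1 i) + rs.2 = m then nordTerm n γ β rs else 0)) = 0 := by
  have h : ∀ rs : (Fin k → ℤ) × ℤ,
      (if (∑ i, rs.1 i) + rs.2 = m then nordTerm n γ β rs else 0) = 0 := fun rs => by
    split_ifs with hrs
    · exact nordTerm_eq_zero γ β rs (hrs ▸ hm)
    · rfl
  simp only [h, finsum_zero, Function.support_fun_zero, Set.finite_empty, and_self]

end
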